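/- arXiv:1001.2850 — 2 statements merged into one kernel-verified Lean document; each statement's English description precedes it below -/
import Mathlib

section
/- Let M ≥ 1. There exists a constant C > 0, depending only on M, such that for all ε, μ ∈ (0,1], all smooth h, b : ℝ² → ℝ with 0 < h(X) ≤ M and |∇b(X)| ≤ M for all X, and all smooth compactly supported v : ℝ² → ℝ², one has ∫_{ℝ²} (𝔗v)·v ≤ C ( |v|₂² + μ |∇·v|₂² + μ |curl v|₂² ), where |·|₂ denotes the L²(ℝ²) norm. -/
open MeasureTheory

noncomputable section

/-- Partial derivative in the first coordinate direction. -/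
def pd1 (f : ℝ × ℝ → ℝ) (x : ℝ × ℝ) : ℝ := fderiv ℝ f x (1, 0)

/-- Partial derivative in the second coordinate direction. -/
def pd2 (f : ℝ × ℝ → ℝ) (x : ℝ × ℝ) : ℝ := fderiv ℝ f x (0, 1)

/-- Gradient of a scalar function on `ℝ²`. -/
def grad (f : ℝ × ℝ → ℝ) (x : ℝ × ℝ) : ℝ × ℝ := (pd1 f x, pd2 f x)

/-- Euclidean dot product on `ℝ²`. -/
def dot (a b : ℝ × ℝ) : ℝ := a.1 * b.1 + a.2 * b.2

/-- Divergence of a vector field on `ℝ²`. -/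
def divg (W : ℝ × ℝ → ℝ × ℝ) (x : ℝ × ℝ) : ℝ :=
  pd1 (fun y => (W y).1) x + pd2 (fun y => (W y).2) x

/-- Scalar curl of a vector field on `ℝ²`: `curl W = ∂₁W₂ - ∂₂W₁`. -/
def curl (W : ℝ × ℝ → ℝ × ℝ) (x : ℝ × ℝ) : ℝ :=
  pd1 (fun y => (W y).2) x - pd2 (fun y => (W y).1) x

/-- `∇⊥ f = (-∂₂ f, ∂₁ f)`. -/
def gradPerp (f : ℝ × ℝ → ℝ) (x : ℝ × ℝ) : ℝ × ℝ := (-(pd2 f x), pd1 f x)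

/-- The Green–Naghdi operator `𝒯[h, εb]`. -/
def Tcal (ε : ℝ) (h b : ℝ × ℝ → ℝ) (W : ℝ × ℝ → ℝ × ℝ) (x : ℝ × ℝ) : ℝ × ℝ :=
  (-(1/3 : ℝ)) • grad (fun y => (h y)^3 * divg W y) x
    + (ε/2) • (grad (fun y => (h y)^2 * dot (grad b y) (W y)) x
        - ((h x)^2 * divg W x) • grad b x)
    + (ε^2 * h x * dot (grad b x) (W x)) • grad b x

/-- The operator `𝔗 = h + μ(𝒯[h,εb] - ∇⊥ curl)`. -/
def Tfrak (ε μ : ℝ) (h b : ℝ × ℝ → ℝ) (W : ℝ × ℝ → ℝ × ℝ) (x : ℝ × ℝ) : ℝ × ℝ :=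
  h x • W x + μ • (Tcal ε h b W x - gradPerp (curl W) x)

lemma contDiff_fderiv_apply_const {f : ℝ × ℝ → ℝ} (hf : ContDiff ℝ (⊤ : ℕ∞) f) (w : ℝ × ℝ) :
    ContDiff ℝ (⊤ : ℕ∞) (fun x => fderiv ℝ f x w) :=
  (hf.fderiv_right (m := (⊤ : ℕ∞)) (by exact_mod_cast le_rfl)).clm_apply contDiff_const

lemma contDiff_divg {W : ℝ × ℝ → ℝ × ℝ} (hW : ContDiff ℝ (⊤ : ℕ∞) W) :
    ContDiff ℝ (⊤ : ℕ∞) (divg W) :=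
  (contDiff_fderiv_apply_const hW.fst (1, 0)).add (contDiff_fderiv_apply_const hW.snd (0, 1))

lemma contDiff_curl {W : ℝ × ℝ → ℝ × ℝ} (hW : ContDiff ℝ (⊤ : ℕ∞) W) :
    ContDiff ℝ (⊤ : ℕ∞) (curl W) :=
  (contDiff_fderiv_apply_const hW.snd (1, 0)).sub (contDiff_fderiv_apply_const hW.fst (0, 1))

lemma contDiff_dot_grad {b : ℝ × ℝ → ℝ} {W : ℝ × ℝ → ℝ × ℝ} (hb : ContDiff ℝ (⊤ : ℕ∞) b)
    (hW : ContDiff ℝ (⊤ : ℕ∞) W) : ContDiff ℝ (⊤ : ℕ∞) (fun x => dot (grad b x) (W x)) :=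
  ((contDiff_fderiv_apply_const hb (1, 0)).mul hW.fst).add
    ((contDiff_fderiv_apply_const hb (0, 1)).mul hW.snd)

/-- The derivatives of both components of `W` vanish off the support of `W`. -/
lemma fderiv_components_eq_zero_of_notMem_tsupport {W : ℝ × ℝ → ℝ × ℝ} {x : ℝ × ℝ}
    (hx : x ∉ tsupport W) :
    fderiv ℝ (fun y => (W y).1) x = 0 ∧ fderiv ℝ (fun y => (W y).2) x = 0 := by
  have h0 : W =ᶠ[nhds x] 0 := notMem_tsupport_iff_eventuallyEq.mp hx
  constructor
  · have h1 : (fun y => (W y).1) =ᶠ[nhds x] fun _ => (0 : ℝ) := h0.mono fun y hy => by simp [hy]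
    simp [h1.fderiv_eq]
  · have h2 : (fun y => (W y).2) =ᶠ[nhds x] fun _ => (0 : ℝ) := h0.mono fun y hy => by simp [hy]
    simp [h2.fderiv_eq]

lemma divg_eq_zero_of_notMem_tsupport {W : ℝ × ℝ → ℝ × ℝ} {x : ℝ × ℝ}
    (hx : x ∉ tsupport W) : divg W x = 0 := by
  obtain ⟨h1, h2⟩ := fderiv_components_eq_zero_of_notMem_tsupport hx
  simp [divg, pd1, pd2, h1, h2]

lemma curl_eq_zero_of_notMem_tsupport {W : ℝ × ℝ → ℝ × ℝ} {x : ℝ × ℝ}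
    (hx : x ∉ tsupport W) : curl W x = 0 := by
  obtain ⟨h1, h2⟩ := fderiv_components_eq_zero_of_notMem_tsupport hx
  simp [curl, pd1, pd2, h1, h2]

lemma integrable_of_eq_zero_off_tsupport {W : ℝ × ℝ → ℝ × ℝ} (hW : HasCompactSupport W)
    {f : ℝ × ℝ → ℝ} (hf : Continuous f) (h0 : ∀ x, x ∉ tsupport W → f x = 0) : Integrable f :=
  hf.integrable_of_hasCompactSupport (HasCompactSupport.intro hW h0)

lemma integral_fderiv_apply_eq_zero {F : ℝ × ℝ → ℝ} (hF : ContDiff ℝ (⊤ : ℕ∞) F)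
    (hc : HasCompactSupport F) (w : ℝ × ℝ) : ∫ x, fderiv ℝ F x w = 0 := by
  have hI : Integrable (fun x => fderiv ℝ F x w) :=
    (contDiff_fderiv_apply_const hF w).continuous.integrable_of_hasCompactSupport
      (hc.fderiv_apply (𝕜 := ℝ) w)
  have := integral_mul_fderiv_eq_neg_fderiv_mul_of_integrable (μ := (volume : Measure (ℝ × ℝ)))
    (f := fun _ => (1 : ℝ)) (g := F) (v := w)
    (by simp) (by simpa using hI)
    (by simpa using hF.continuous.integrable_of_hasCompactSupport hc)
    (by fun_prop) (fun x _ => hF.differentiable (by simp) x)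
  simpa using this

lemma integrable_dot_grad_add_mul_divg {φ : ℝ × ℝ → ℝ} {W : ℝ × ℝ → ℝ × ℝ}
    (hφ : ContDiff ℝ (⊤ : ℕ∞) φ) (hW : ContDiff ℝ (⊤ : ℕ∞) W) (hc : HasCompactSupport W) :
    Integrable (fun x => dot (grad φ x) (W x) + φ x * divg W x) := by
  refine integrable_of_eq_zero_off_tsupport hc
    ((contDiff_dot_grad hφ hW).continuous.add (hφ.continuous.mul (contDiff_divg hW).continuous)) ?_
  intro x hx
  simp [dot, divg_eq_zero_of_notMem_tsupport hx, image_eq_zero_of_notMem_tsupport hx]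

/-- The divergence theorem for the compactly supported field `φ W`. -/
lemma integral_dot_grad_add_mul_divg {φ : ℝ × ℝ → ℝ} {W : ℝ × ℝ → ℝ × ℝ}
    (hφ : ContDiff ℝ (⊤ : ℕ∞) φ) (hW : ContDiff ℝ (⊤ : ℕ∞) W) (hc : HasCompactSupport W) :
    ∫ x, (dot (grad φ x) (W x) + φ x * divg W x) = 0 := by
  have hc1 : HasCompactSupport (fun x => φ x * (W x).1) :=
    HasCompactSupport.intro hc fun x hx => by simp [image_eq_zero_of_notMem_tsupport hx]
  have hc2 : HasCompactSupport (fun x => φ x * (W x).2) :=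
    HasCompactSupport.intro hc fun x hx => by simp [image_eq_zero_of_notMem_tsupport hx]
  have hs1 := hφ.mul hW.fst
  have hs2 := hφ.mul hW.snd
  have hd : Differentiable ℝ φ := hφ.differentiable (by simp)
  have hd1 : Differentiable ℝ (fun x => (W x).1) := hW.fst.differentiable (by simp)
  have hd2 : Differentiable ℝ (fun x => (W x).2) := hW.snd.differentiable (by simp)
  have key : ∀ x, dot (grad φ x) (W x) + φ x * divg W x
      = fderiv ℝ (fun x => φ x * (W x).1) x (1, 0)
        + fderiv ℝ (fun x => φ x * (W x).2) x (0, 1) := by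
    intro x
    rw [fderiv_fun_mul (hd x) (hd1 x), fderiv_fun_mul (hd x) (hd2 x)]
    simp only [dot, grad, divg, pd1, pd2, add_apply,
      smul_apply, smul_eq_mul]
    ring
  simp_rw [key]
  rw [integral_add, integral_fderiv_apply_eq_zero hs1 hc1, integral_fderiv_apply_eq_zero hs2 hc2,
    add_zero]
  · exact (contDiff_fderiv_apply_const hs1 _).continuous.integrable_of_hasCompactSupport
      (hc1.fderiv_apply (𝕜 := ℝ) _)
  · exact (contDiff_fderiv_apply_const hs2 _).continuous.integrable_of_hasCompactSupport
      (hc2.fderiv_apply (𝕜 := ℝ) _)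

/-- The quadratic density obtained from `(𝔗v)·v` after integration by parts. -/
def energyDensity (ε μ : ℝ) (h b : ℝ × ℝ → ℝ) (v : ℝ × ℝ → ℝ × ℝ) (x : ℝ × ℝ) : ℝ :=
  h x * dot (v x) (v x) + μ * ((1/3) * (h x)^3 * (divg v x)^2
    - ε * (h x)^2 * dot (grad b x) (v x) * divg v x
    + ε^2 * h x * (dot (grad b x) (v x))^2 + (curl v x)^2)

lemma integrable_energyDensity (ε μ : ℝ) {h b : ℝ × ℝ → ℝ} {v : ℝ × ℝ → ℝ × ℝ}
    (hh : ContDiff ℝ (⊤ : ℕ∞) h) (hb : ContDiff ℝ (⊤ : ℕ∞) b)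
    (hv : ContDiff ℝ (⊤ : ℕ∞) v) (hc : HasCompactSupport v) :
    Integrable (energyDensity ε μ h b v) := by
  have c1 := hh.continuous
  have c2 := hv.continuous
  have c3 := (contDiff_divg hv).continuous
  have c4 := (contDiff_curl hv).continuous
  have c5 := (contDiff_dot_grad hb hv).continuous
  refine integrable_of_eq_zero_off_tsupport hc ?_ fun x hx => ?_
  · have c6 : Continuous (fun x => dot (v x) (v x)) := by unfold dot; fun_prop
    unfold energyDensity
    fun_prop
  · simp [energyDensity, dot, divg_eq_zero_of_notMem_tsupport hx,
      curl_eq_zero_of_notMem_tsupport hx, image_eq_zero_of_notMem_tsupport hx]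

lemma integral_dot_Tfrak (ε μ : ℝ) {h b : ℝ × ℝ → ℝ} {v : ℝ × ℝ → ℝ × ℝ}
    (hh : ContDiff ℝ (⊤ : ℕ∞) h) (hb : ContDiff ℝ (⊤ : ℕ∞) b)
    (hv : ContDiff ℝ (⊤ : ℕ∞) v) (hc : HasCompactSupport v) :
    ∫ x, dot (Tfrak ε μ h b v x) (v x) = ∫ x, energyDensity ε μ h b v x := by
  set w : ℝ × ℝ → ℝ × ℝ := fun x => ((v x).2, -(v x).1) with hw
  have hws : ContDiff ℝ (⊤ : ℕ∞) w := hv.snd.prodMk hv.fst.neg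
  have hwc : HasCompactSupport w :=
    HasCompactSupport.intro hc fun x hx => by simp [hw, image_eq_zero_of_notMem_tsupport hx]
  have hdiv : ∀ x, divg w x = curl v x := fun x => by
    simp only [divg, curl, pd1, pd2, hw, fderiv_fun_neg, neg_apply]
    ring
  have hφ₁ := (hh.pow 3).mul (contDiff_divg hv)
  have hφ₂ := (hh.pow 2).mul (contDiff_dot_grad hb hv)
  have hφ₃ := contDiff_curl hv
  have i0 := integrable_energyDensity ε μ hh hb hv hc
  have i1 := (integrable_dot_grad_add_mul_divg hφ₁ hv hc).const_mul (-(μ / 3))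
  have i2 := (integrable_dot_grad_add_mul_divg hφ₂ hv hc).const_mul (μ * ε / 2)
  have i3 := (integrable_dot_grad_add_mul_divg hφ₃ hws hwc).const_mul (-μ)
  have key : ∀ x, dot (Tfrak ε μ h b v x) (v x) = energyDensity ε μ h b v x
      + -(μ / 3) * (dot (grad (fun y => (h y)^3 * divg v y) x) (v x)
        + (h x)^3 * divg v x * divg v x)
      + μ * ε / 2 * (dot (grad (fun y => (h y)^2 * dot (grad b y) (v y)) x) (v x)
        + (h x)^2 * dot (grad b x) (v x) * divg v x)
      + -μ * (dot (grad (curl v) x) (w x) + curl v x * divg w x) := by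
    intro x
    rw [hdiv]
    generalize hg1 : grad (fun y => (h y)^3 * divg v y) x = g1
    generalize hg2 : grad (fun y => (h y)^2 * dot (grad b y) (v y)) x = g2
    simp only [Tfrak, Tcal, energyDensity, hg1, hg2]
    simp only [dot, gradPerp, grad, hw, Prod.fst_add, Prod.snd_add, Prod.fst_sub, Prod.snd_sub,
      Prod.smul_fst, Prod.smul_snd, smul_eq_mul]
    ring
  simp_rw [key]
  rw [integral_add ((i0.fun_add i1).fun_add i2) i3, integral_add (i0.fun_add i1) i2, integral_add i0 i1,
    integral_const_mul, integral_const_mul, integral_const_mul,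
    integral_dot_grad_add_mul_divg hφ₁ hv hc, integral_dot_grad_add_mul_divg hφ₂ hv hc,
    integral_dot_grad_add_mul_divg hφ₃ hws hwc]
  simp

lemma dot_sq_le (a b : ℝ × ℝ) : (dot a b)^2 ≤ dot a a * dot b b := by
  unfold dot
  nlinarith [sq_nonneg (a.1 * b.2 - a.2 * b.1)]

lemma energyDensity_le {M ε μ : ℝ} (hM : 1 ≤ M) (hε : ε ∈ Set.Ioc (0:ℝ) 1)
    (hμ : μ ∈ Set.Ioc (0:ℝ) 1) {h b : ℝ × ℝ → ℝ} {v : ℝ × ℝ → ℝ × ℝ} {x : ℝ × ℝ}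
    (h0 : 0 < h x) (hhM : h x ≤ M) (hbM : dot (grad b x) (grad b x) ≤ M^2) :
    energyDensity ε μ h b v x
      ≤ 3 * M^4 * (dot (v x) (v x) + μ * (divg v x)^2 + μ * (curl v x)^2) := by
  obtain ⟨hε0, hε1⟩ := hε
  obtain ⟨hμ0, hμ1⟩ := hμ
  have hV : 0 ≤ dot (v x) (v x) := by unfold dot; nlinarith [sq_nonneg (v x).1, sq_nonneg (v x).2]
  have hβ : (dot (grad b x) (v x))^2 ≤ M^2 * dot (v x) (v x) :=
    (dot_sq_le _ _).trans (mul_le_mul_of_nonneg_right hbM hV)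
  unfold energyDensity
  generalize dot (v x) (v x) = V at *
  generalize dot (grad b x) (v x) = β at *
  generalize divg v x = D at *
  generalize curl v x = c at *
  generalize h x = k at *
  have hM0 : 0 ≤ M := by linarith
  have hD := sq_nonneg D
  have hc := sq_nonneg c
  have p1 : M ≤ M^4 := le_self_pow₀ hM (by norm_num)
  have p2 : M^2 ≤ M^4 := pow_le_pow_right₀ hM (by norm_num)
  have p3 : M^3 ≤ M^4 := pow_le_pow_right₀ hM (by norm_num)
  have p4 : 1 ≤ M^4 := one_le_pow₀ hM
  have k2 : k^2 ≤ M^2 := pow_le_pow_left₀ h0.le hhM 2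
  have k3 : k^3 ≤ M^3 := pow_le_pow_left₀ h0.le hhM 3
  have e1 : k * V ≤ M^4 * V := mul_le_mul_of_nonneg_right (hhM.trans p1) hV
  have e2 : k^3 * D^2 ≤ M^4 * D^2 := mul_le_mul_of_nonneg_right (k3.trans p3) hD
  have e3 : -(ε * k^2 * β * D) ≤ M^4 * V / 2 + M^4 * D^2 / 2 := by
    have a1 : -(ε * k^2 * β * D) ≤ k^2 * (β^2 + D^2) / 2 := by
      have : -(ε * β * D) ≤ (β^2 + D^2) / 2 := by
        nlinarith [sq_nonneg (ε * β + D), mul_nonneg (sq_nonneg β)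
          (mul_nonneg (sub_nonneg.2 hε1) (by linarith : (0:ℝ) ≤ 1 + ε))]
      nlinarith [mul_le_mul_of_nonneg_left this (sq_nonneg k)]
    have a2 : k^2 * β^2 ≤ M^2 * (M^2 * V) := by gcongr
    have a3 : k^2 * D^2 ≤ M^4 * D^2 := mul_le_mul_of_nonneg_right (k2.trans p2) hD
    nlinarith
  have e4 : ε^2 * k * β^2 ≤ M^4 * V := by
    have a1 : ε^2 ≤ 1 := pow_le_one₀ hε0.le hε1
    have a2 : ε^2 * k * β^2 ≤ 1 * M * (M^2 * V) := by gcongr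
    nlinarith [mul_le_mul_of_nonneg_right p3 hV]
  have e5 : c^2 ≤ M^4 * c^2 := le_mul_of_one_le_left hc p4
  have q1 : 0 ≤ M^4 * V := by positivity
  have q2 : 0 ≤ M^4 * D^2 := by positivity
  have e6 : μ * ((1/3) * k^3 * D^2 - ε * k^2 * β * D + ε^2 * k * β^2 + c^2)
      ≤ μ * (3/2 * (M^4 * V) + 3 * (M^4 * D^2) + 3 * (M^4 * c^2)) :=
    mul_le_mul_of_nonneg_left (by linarith) hμ0.le
  have e7 : μ * (M^4 * V) ≤ M^4 * V := mul_le_of_le_one_left q1 hμ1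
  linarith

/-- Lemma 3, `s = 0`, first inequality: the energy `(v, 𝔗v)` is bounded above by the
`X⁰`-norm, uniformly in `ε, μ ∈ (0,1]`. -/
theorem energy_le_X0_norm (M : ℝ) (hM : 1 ≤ M) :
    ∃ C : ℝ, 0 < C ∧
      ∀ (ε μ : ℝ), ε ∈ Set.Ioc (0:ℝ) 1 → μ ∈ Set.Ioc (0:ℝ) 1 →
      ∀ (h b : ℝ × ℝ → ℝ), ContDiff ℝ (⊤ : ℕ∞) h → ContDiff ℝ (⊤ : ℕ∞) b →
      (∀ x, 0 < h x) → (∀ x, h x ≤ M) →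
      (∀ x, dot (grad b x) (grad b x) ≤ M^2) →
      ∀ (v : ℝ × ℝ → ℝ × ℝ), ContDiff ℝ (⊤ : ℕ∞) v → HasCompactSupport v →
      (∫ x : ℝ × ℝ, dot (Tfrak ε μ h b v x) (v x))
        ≤ C * ((∫ x : ℝ × ℝ, dot (v x) (v x))
            + μ * (∫ x : ℝ × ℝ, (divg v x)^2)
            + μ * ∫ x : ℝ × ℝ, (curl v x)^2) := by

  refine ⟨3 * M^4, by positivity, ?_⟩
  intro ε μ hε hμ h b hh hb h0 hhM hbM v hv hc
  have iV : Integrable (fun x => dot (v x) (v x)) := by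
    have := hv.continuous
    refine integrable_of_eq_zero_off_tsupport hc (by unfold dot; fun_prop) fun x hx => ?_
    simp [dot, image_eq_zero_of_notMem_tsupport hx]
  have iD : Integrable (fun x => μ * (divg v x)^2) :=
    (integrable_of_eq_zero_off_tsupport hc ((contDiff_divg hv).continuous.pow 2) fun x hx => by
      simp [divg_eq_zero_of_notMem_tsupport hx]).const_mul μ
  have iC : Integrable (fun x => μ * (curl v x)^2) :=
    (integrable_of_eq_zero_off_tsupport hc ((contDiff_curl hv).continuous.pow 2) fun x hx => by
      simp [curl_eq_zero_of_notMem_tsupport hx]).const_mul μ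
  rw [integral_dot_Tfrak ε μ hh hb hv hc, ← integral_const_mul, ← integral_const_mul,
    ← integral_add iV iD, ← integral_add (iV.fun_add iD) iC, ← integral_const_mul]
  exact integral_mono (integrable_energyDensity ε μ hh hb hv hc)
    (((iV.fun_add iD).fun_add iC).const_mul _)
    fun x => energyDensity_le hM hε hμ (h0 x) (hhM x) (hbM x)

end
end

section
/- Let u = (U₁,U₂) : ℝ² → ℝ² be a smooth vector field all of whose first-order partial derivatives are bounded in absolute value by M ≥ 0, and let w : ℝ² → ℝ² be smooth with compact support. Then | ∫_{ℝ²} curl((u·∇)w) · curl w | ≤ 3 M ( |∇·w|₂² + |curl w|₂² ), where |·|₂ denotes the L²(ℝ²) norm, ∇·w = ∂₁w₁ + ∂₂w₂ and curl w = ∂₁w₂ - ∂₂w₁. -/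
open MeasureTheory

noncomputable section

/-- The advection term `(u·∇)w`, componentwise. -/
def advect (u w : ℝ × ℝ → ℝ × ℝ) (y : ℝ × ℝ) : ℝ × ℝ :=
  (dot (u y) (grad (fun z => (w z).1) y), dot (u y) (grad (fun z => (w z).2) y))

theorem integral_fderiv_apply_eq_zero_of_hasCompactSupport {f : ℝ × ℝ → ℝ}
    (hf : ContDiff ℝ 1 f) (hs : HasCompactSupport f) (v : ℝ × ℝ) :
    ∫ x, fderiv ℝ f x v = 0 := by
  have hi : Integrable (fun x => fderiv ℝ f x v) :=
    ((hf.continuous_fderiv one_ne_zero).clm_apply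
      continuous_const).integrable_of_hasCompactSupport (hs.fderiv_apply (𝕜 := ℝ) v)
  have h := integral_mul_fderiv_eq_neg_fderiv_mul_of_integrable (μ := volume) (v := v)
    (f := f) (g := fun _ => (1 : ℝ)) (by simpa using hi) (by simp)
    (by simpa using hf.continuous.integrable_of_hasCompactSupport hs)
    (fun x _ => hf.differentiable one_ne_zero x) (fun x _ => differentiableAt_const _)
  simpa using h

theorem contDiff_pd1 {f : ℝ × ℝ → ℝ} (hf : ContDiff ℝ (⊤ : ℕ∞) f) :
    ContDiff ℝ (⊤ : ℕ∞) (pd1 f) :=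
  (hf.fderiv_right (m := (⊤ : ℕ∞)) le_rfl).clm_apply contDiff_const

theorem contDiff_pd2 {f : ℝ × ℝ → ℝ} (hf : ContDiff ℝ (⊤ : ℕ∞) f) :
    ContDiff ℝ (⊤ : ℕ∞) (pd2 f) :=
  (hf.fderiv_right (m := (⊤ : ℕ∞)) le_rfl).clm_apply contDiff_const

theorem hasCompactSupport_pd1 {f : ℝ × ℝ → ℝ} (hf : HasCompactSupport f) :
    HasCompactSupport (pd1 f) :=
  hf.fderiv_apply (𝕜 := ℝ) (1, 0)

theorem hasCompactSupport_pd2 {f : ℝ × ℝ → ℝ} (hf : HasCompactSupport f) :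
    HasCompactSupport (pd2 f) :=
  hf.fderiv_apply (𝕜 := ℝ) (0, 1)

theorem pd1_pd2_comm {f : ℝ × ℝ → ℝ} (hf : ContDiff ℝ (⊤ : ℕ∞) f) (x : ℝ × ℝ) :
    pd1 (pd2 f) x = pd2 (pd1 f) x := by
  have hd : DifferentiableAt ℝ (fderiv ℝ f) x :=
    (hf.fderiv_right (m := (⊤ : ℕ∞)) le_rfl).differentiable (by simp) x
  have key (v v' : ℝ × ℝ) :
      fderiv ℝ (fun y => fderiv ℝ f y v) x v' = fderiv ℝ (fderiv ℝ f) x v' v := by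
    rw [fderiv_clm_apply hd (differentiableAt_const v)]
    simp
  change fderiv ℝ (fun y => fderiv ℝ f y (0, 1)) x (1, 0)
    = fderiv ℝ (fun y => fderiv ℝ f y (1, 0)) x (0, 1)
  rw [key, key]
  exact (hf.contDiffAt.isSymmSndFDerivAt (by
    rw [minSmoothness_of_isRCLikeNormedField]
    exact WithTop.coe_le_coe.2 (le_top : (2 : ℕ∞) ≤ ⊤))).eq _ _

theorem pd1_add {f g : ℝ × ℝ → ℝ} (hf : Differentiable ℝ f) (hg : Differentiable ℝ g)
    (x : ℝ × ℝ) : pd1 (fun y => f y + g y) x = pd1 f x + pd1 g x := by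
  simp [pd1, fderiv_fun_add (hf x) (hg x)]

theorem pd2_add {f g : ℝ × ℝ → ℝ} (hf : Differentiable ℝ f) (hg : Differentiable ℝ g)
    (x : ℝ × ℝ) : pd2 (fun y => f y + g y) x = pd2 f x + pd2 g x := by
  simp [pd2, fderiv_fun_add (hf x) (hg x)]

theorem pd1_sub {f g : ℝ × ℝ → ℝ} (hf : Differentiable ℝ f) (hg : Differentiable ℝ g)
    (x : ℝ × ℝ) : pd1 (fun y => f y - g y) x = pd1 f x - pd1 g x := by
  simp [pd1, fderiv_fun_sub (hf x) (hg x)]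

theorem pd2_sub {f g : ℝ × ℝ → ℝ} (hf : Differentiable ℝ f) (hg : Differentiable ℝ g)
    (x : ℝ × ℝ) : pd2 (fun y => f y - g y) x = pd2 f x - pd2 g x := by
  simp [pd2, fderiv_fun_sub (hf x) (hg x)]

theorem pd1_mul {f g : ℝ × ℝ → ℝ} (hf : Differentiable ℝ f) (hg : Differentiable ℝ g)
    (x : ℝ × ℝ) : pd1 (fun y => f y * g y) x = f x * pd1 g x + g x * pd1 f x := by
  simp [pd1, fderiv_fun_mul (hf x) (hg x)]

theorem pd2_mul {f g : ℝ × ℝ → ℝ} (hf : Differentiable ℝ f) (hg : Differentiable ℝ g)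
    (x : ℝ × ℝ) : pd2 (fun y => f y * g y) x = f x * pd2 g x + g x * pd2 f x := by
  simp [pd2, fderiv_fun_mul (hf x) (hg x)]

/-- The integral of the divergence of a compactly supported field vanishes. -/
theorem integral_pd1_add_pd2_eq_zero {f g : ℝ × ℝ → ℝ}
    (hf : ContDiff ℝ (⊤ : ℕ∞) f) (hfs : HasCompactSupport f)
    (hg : ContDiff ℝ (⊤ : ℕ∞) g) (hgs : HasCompactSupport g) :
    ∫ x, (pd1 f x + pd2 g x) = 0 := by
  rw [integral_add
    ((contDiff_pd1 hf).continuous.integrable_of_hasCompactSupport (hasCompactSupport_pd1 hfs))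
    ((contDiff_pd2 hg).continuous.integrable_of_hasCompactSupport (hasCompactSupport_pd2 hgs))]
  simp only [pd1, pd2]
  rw [integral_fderiv_apply_eq_zero_of_hasCompactSupport (hf.of_le (by simp)) hfs,
    integral_fderiv_apply_eq_zero_of_hasCompactSupport (hg.of_le (by simp)) hgs, add_zero]

/-- Pointwise bound on the part of `curl ((u·∇)w) · curl w` that is not a divergence. -/
theorem abs_transport_quadratic_le {M p q r s a b c d : ℝ}
    (hp : |p| ≤ M) (hq : |q| ≤ M) (hr : |r| ≤ M) (hs : |s| ≤ M) :
    |(p - s) * (c ^ 2 - b ^ 2) / 2 + (r * d - q * a) * (c - b)|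
      ≤ M * (a ^ 2 + b ^ 2 + c ^ 2 + d ^ 2 + (c - b) ^ 2) := by
  have mul_bound {k y z : ℝ} (hk : |k| ≤ M) (hy : |y| ≤ z) : |k * y| ≤ M * z := by
    rw [abs_mul]
    exact mul_le_mul hk hy (abs_nonneg _) ((abs_nonneg _).trans hk)
  have hyp : |(c ^ 2 - b ^ 2) / 2| ≤ (c ^ 2 + b ^ 2) / 2 := by
    rw [abs_le]; constructor <;> nlinarith [sq_nonneg b, sq_nonneg c]
  have young (y : ℝ) : |y * (c - b)| ≤ (y ^ 2 + (c - b) ^ 2) / 2 := by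
    rw [abs_le]; constructor <;> nlinarith [sq_nonneg (y - (c - b)), sq_nonneg (y + (c - b))]
  have h1 := abs_le.1 (mul_bound hp hyp)
  have h2 := abs_le.1 (mul_bound hs hyp)
  have h3 := abs_le.1 (mul_bound hr (young d))
  have h4 := abs_le.1 (mul_bound hq (young a))
  have hM : 0 ≤ M := (abs_nonneg _).trans hp
  have h5 : 0 ≤ M * (a ^ 2 + d ^ 2) := by positivity
  rw [abs_le]
  constructor <;> linarith [h1.1, h1.2, h2.1, h2.2, h3.1, h3.2, h4.1, h4.2]

theorem integrable_sq_of_hasCompactSupport {f : ℝ × ℝ → ℝ} (hf : ContDiff ℝ (⊤ : ℕ∞) f)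
    (hs : HasCompactSupport f) : Integrable (fun x => f x ^ 2) := by
  simp_rw [sq]
  exact (hf.continuous.mul hf.continuous).integrable_of_hasCompactSupport hs.mul_left

/-- The sum of the squared gradients of the components of a field on `ℝ²`. -/
def gradSq (w₁ w₂ : ℝ × ℝ → ℝ) (x : ℝ × ℝ) : ℝ :=
  pd1 w₁ x ^ 2 + pd2 w₁ x ^ 2 + pd1 w₂ x ^ 2 + pd2 w₂ x ^ 2

theorem integrable_gradSq {w₁ w₂ : ℝ × ℝ → ℝ}
    (cw₁ : ContDiff ℝ (⊤ : ℕ∞) w₁) (sw₁ : HasCompactSupport w₁)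
    (cw₂ : ContDiff ℝ (⊤ : ℕ∞) w₂) (sw₂ : HasCompactSupport w₂) :
    Integrable (gradSq w₁ w₂) :=
  (((integrable_sq_of_hasCompactSupport (contDiff_pd1 cw₁) (hasCompactSupport_pd1 sw₁)).add
    (integrable_sq_of_hasCompactSupport (contDiff_pd2 cw₁) (hasCompactSupport_pd2 sw₁))).add
    (integrable_sq_of_hasCompactSupport (contDiff_pd1 cw₂) (hasCompactSupport_pd1 sw₂))).add
    (integrable_sq_of_hasCompactSupport (contDiff_pd2 cw₂) (hasCompactSupport_pd2 sw₂))

/-- The `L²` norm of the gradient is controlled by the divergence and the curl. -/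
theorem integral_gradSq_eq {w₁ w₂ : ℝ × ℝ → ℝ}
    (cw₁ : ContDiff ℝ (⊤ : ℕ∞) w₁) (sw₁ : HasCompactSupport w₁)
    (cw₂ : ContDiff ℝ (⊤ : ℕ∞) w₂) (sw₂ : HasCompactSupport w₂) :
    ∫ x, gradSq w₁ w₂ x
      = (∫ x, (pd1 w₁ x + pd2 w₂ x) ^ 2) + ∫ x, (pd1 w₂ x - pd2 w₁ x) ^ 2 := by
  have cc := contDiff_pd1 cw₂
  have cd := contDiff_pd2 cw₂
  have iD := integrable_sq_of_hasCompactSupport ((contDiff_pd1 cw₁).add cd)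
    ((hasCompactSupport_pd1 sw₁).add (hasCompactSupport_pd2 sw₂))
  have iW := integrable_sq_of_hasCompactSupport (cc.sub (contDiff_pd2 cw₁))
    ((hasCompactSupport_pd1 sw₂).sub (hasCompactSupport_pd2 sw₁))
  have cf := cw₁.mul cd
  have cg := cw₁.mul cc.neg
  have sf : HasCompactSupport (fun x => w₁ x * pd2 w₂ x) := sw₁.mul_right
  have sg : HasCompactSupport (fun x => w₁ x * -pd1 w₂ x) := sw₁.mul_right
  have null := integral_pd1_add_pd2_eq_zero cf sf cg sg
  have iN : Integrable (fun x => pd1 (fun y => w₁ y * pd2 w₂ y) x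
      + pd2 (fun y => w₁ y * -pd1 w₂ y) x) :=
    ((contDiff_pd1 cf).add (contDiff_pd2 cg)).continuous.integrable_of_hasCompactSupport
      ((hasCompactSupport_pd1 sf).add (hasCompactSupport_pd2 sg))
  have pointwise (x : ℝ × ℝ) : (pd1 w₁ x + pd2 w₂ x) ^ 2 + (pd1 w₂ x - pd2 w₁ x) ^ 2
      = gradSq w₁ w₂ x + 2 * (pd1 (fun y => w₁ y * pd2 w₂ y) x
        + pd2 (fun y => w₁ y * -pd1 w₂ y) x) := by
    have e : pd2 (fun y => -pd1 w₂ y) x = -pd2 (pd1 w₂) x := by simp [pd2]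
    rw [pd1_mul (cw₁.differentiable (by simp)) (cd.differentiable (by simp)),
      pd2_mul (cw₁.differentiable (by simp)) (cc.neg.differentiable (by simp)), e,
      pd1_pd2_comm cw₂, gradSq]
    ring
  rw [← integral_add iD iW]
  simp_rw [pointwise]
  rw [integral_add (integrable_gradSq cw₁ sw₁ cw₂ sw₂) (iN.const_mul _),
    integral_const_mul, null, mul_zero, add_zero]

/-- Green's identity for the transport of a compactly supported scalar. -/
theorem integral_transport_mul_self {U₁ U₂ ω : ℝ × ℝ → ℝ}
    (cU₁ : ContDiff ℝ (⊤ : ℕ∞) U₁) (cU₂ : ContDiff ℝ (⊤ : ℕ∞) U₂)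
    (cω : ContDiff ℝ (⊤ : ℕ∞) ω) (sω : HasCompactSupport ω) {F K : ℝ × ℝ → ℝ}
    (iK : Integrable K)
    (hF : ∀ x, F x = K x + (U₁ x * pd1 ω x + U₂ x * pd2 ω x) * ω x
      + (pd1 U₁ x + pd2 U₂ x) * ω x ^ 2 / 2) :
    ∫ x, F x = ∫ x, K x := by
  have cω2 : ContDiff ℝ (⊤ : ℕ∞) (fun y => ω y * ω y) := cω.mul cω
  have sω2 : HasCompactSupport (fun y => ω y * ω y) := sω.mul_left
  have cf := cU₁.mul cω2
  have cg := cU₂.mul cω2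
  have sf : HasCompactSupport (fun y => U₁ y * (ω y * ω y)) := sω2.mul_left
  have sg : HasCompactSupport (fun y => U₂ y * (ω y * ω y)) := sω2.mul_left
  have null := integral_pd1_add_pd2_eq_zero cf sf cg sg
  have iN : Integrable (fun x => pd1 (fun y => U₁ y * (ω y * ω y)) x
      + pd2 (fun y => U₂ y * (ω y * ω y)) x) :=
    ((contDiff_pd1 cf).add (contDiff_pd2 cg)).continuous.integrable_of_hasCompactSupport
      ((hasCompactSupport_pd1 sf).add (hasCompactSupport_pd2 sg))
  have pointwise (x : ℝ × ℝ) : F x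
      = K x + (1 / 2) * (pd1 (fun y => U₁ y * (ω y * ω y)) x
        + pd2 (fun y => U₂ y * (ω y * ω y)) x) := by
    have dω : Differentiable ℝ ω := cω.differentiable (by simp)
    have dω2 : Differentiable ℝ (fun y => ω y * ω y) := cω2.differentiable (by simp)
    rw [hF, pd1_mul (cU₁.differentiable (by simp)) dω2,
      pd2_mul (cU₂.differentiable (by simp)) dω2, pd1_mul dω dω, pd2_mul dω dω]
    ring
  simp_rw [pointwise]
  rw [integral_add iK (iN.const_mul _), integral_const_mul, null, mul_zero, add_zero]

/-- The curl of the advection term, in coordinates. -/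
theorem pd1_transport_sub_pd2_transport {U₁ U₂ w₁ w₂ : ℝ × ℝ → ℝ}
    (cU₁ : ContDiff ℝ (⊤ : ℕ∞) U₁) (cU₂ : ContDiff ℝ (⊤ : ℕ∞) U₂)
    (cw₁ : ContDiff ℝ (⊤ : ℕ∞) w₁) (cw₂ : ContDiff ℝ (⊤ : ℕ∞) w₂) (x : ℝ × ℝ) :
    pd1 (fun y => U₁ y * pd1 w₂ y + U₂ y * pd2 w₂ y) x
        - pd2 (fun y => U₁ y * pd1 w₁ y + U₂ y * pd2 w₁ y) x
      = U₁ x * pd1 (fun y => pd1 w₂ y - pd2 w₁ y) x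
        + U₂ x * pd2 (fun y => pd1 w₂ y - pd2 w₁ y) x
        + (pd1 U₁ x * pd1 w₂ x + pd1 U₂ x * pd2 w₂ x
          - pd2 U₁ x * pd1 w₁ x - pd2 U₂ x * pd2 w₁ x) := by
  have diff {f : ℝ × ℝ → ℝ} (hf : ContDiff ℝ (⊤ : ℕ∞) f) : Differentiable ℝ f :=
    hf.differentiable (by simp)
  have ca := contDiff_pd1 cw₁
  have cb := contDiff_pd2 cw₁
  have cc := contDiff_pd1 cw₂
  have cd := contDiff_pd2 cw₂
  rw [pd1_add (diff (cU₁.mul cc)) (diff (cU₂.mul cd)),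
    pd2_add (diff (cU₁.mul ca)) (diff (cU₂.mul cb)),
    pd1_mul (diff cU₁) (diff cc), pd1_mul (diff cU₂) (diff cd),
    pd2_mul (diff cU₁) (diff ca), pd2_mul (diff cU₂) (diff cb),
    pd1_sub (diff cc) (diff cb), pd2_sub (diff cc) (diff cb),
    pd1_pd2_comm cw₂, pd1_pd2_comm cw₁]
  ring

/-- The transport estimate in coordinates. -/
theorem abs_integral_transport_le {M : ℝ} {U₁ U₂ w₁ w₂ : ℝ × ℝ → ℝ}
    (cU₁ : ContDiff ℝ (⊤ : ℕ∞) U₁) (cU₂ : ContDiff ℝ (⊤ : ℕ∞) U₂)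
    (h11 : ∀ x, |pd1 U₁ x| ≤ M) (h12 : ∀ x, |pd2 U₁ x| ≤ M)
    (h21 : ∀ x, |pd1 U₂ x| ≤ M) (h22 : ∀ x, |pd2 U₂ x| ≤ M)
    (cw₁ : ContDiff ℝ (⊤ : ℕ∞) w₁) (sw₁ : HasCompactSupport w₁)
    (cw₂ : ContDiff ℝ (⊤ : ℕ∞) w₂) (sw₂ : HasCompactSupport w₂) :
    |∫ x, (pd1 (fun y => U₁ y * pd1 w₂ y + U₂ y * pd2 w₂ y) x
        - pd2 (fun y => U₁ y * pd1 w₁ y + U₂ y * pd2 w₁ y) x) * (pd1 w₂ x - pd2 w₁ x)|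
      ≤ M * ((∫ x, (pd1 w₁ x + pd2 w₂ x) ^ 2) + (∫ x, (pd1 w₂ x - pd2 w₁ x) ^ 2)
        + ∫ x, (pd1 w₂ x - pd2 w₁ x) ^ 2) := by
  have ca := contDiff_pd1 cw₁
  have cb := contDiff_pd2 cw₁
  have cc := contDiff_pd1 cw₂
  have cd := contDiff_pd2 cw₂
  have cω : ContDiff ℝ (⊤ : ℕ∞) (fun x => pd1 w₂ x - pd2 w₁ x) := cc.sub cb
  have sω : HasCompactSupport (fun x => pd1 w₂ x - pd2 w₁ x) :=
    (hasCompactSupport_pd1 sw₂).sub (hasCompactSupport_pd2 sw₁)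
  have iS := integrable_gradSq cw₁ sw₁ cw₂ sw₂
  have iW := integrable_sq_of_hasCompactSupport cω sω
  have iB := (iS.add iW).const_mul M
  let K : ℝ × ℝ → ℝ := fun x =>
    (pd1 U₁ x - pd2 U₂ x) * (pd1 w₂ x ^ 2 - pd2 w₁ x ^ 2) / 2
      + (pd1 U₂ x * pd2 w₂ x - pd2 U₁ x * pd1 w₁ x) * (pd1 w₂ x - pd2 w₁ x)
  have cK : Continuous K := by
    have := ca.continuous
    have := cb.continuous
    have := cc.continuous
    have := cd.continuous
    have := (contDiff_pd1 cU₁).continuous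
    have := (contDiff_pd2 cU₁).continuous
    have := (contDiff_pd1 cU₂).continuous
    have := (contDiff_pd2 cU₂).continuous
    fun_prop
  have bound (x : ℝ × ℝ) :
      ‖K x‖ ≤ M * (gradSq w₁ w₂ x + (pd1 w₂ x - pd2 w₁ x) ^ 2) :=
    abs_transport_quadratic_le (h11 x) (h12 x) (h21 x) (h22 x)
  have iK : Integrable K := iB.mono' cK.aestronglyMeasurable (.of_forall bound)
  rw [integral_transport_mul_self cU₁ cU₂ cω sω iK fun x => by
    rw [pd1_transport_sub_pd2_transport cU₁ cU₂ cw₁ cw₂]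
    simp only [K]
    ring]
  calc |∫ x, K x|
      ≤ ∫ x, M * (gradSq w₁ w₂ x + (pd1 w₂ x - pd2 w₁ x) ^ 2) :=
        norm_integral_le_of_norm_le iB (.of_forall bound)
    _ = _ := by
      rw [integral_const_mul, integral_add iS iW, integral_gradSq_eq cw₁ sw₁ cw₂ sw₂]

/-- The transport term estimate: the `X⁰`-type norm `|∇·w|₂² + |curl w|₂²`
controls `∫ curl((u·∇)w)·curl w` when the first derivatives of `u` are bounded by `M`. -/
theorem curl_advect_estimate (M : ℝ) (hM : 0 ≤ M)
    (u w : ℝ × ℝ → ℝ × ℝ) (hu : ContDiff ℝ (⊤ : ℕ∞) u)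
    (hu11 : ∀ x, |pd1 (fun y => (u y).1) x| ≤ M)
    (hu12 : ∀ x, |pd2 (fun y => (u y).1) x| ≤ M)
    (hu21 : ∀ x, |pd1 (fun y => (u y).2) x| ≤ M)
    (hu22 : ∀ x, |pd2 (fun y => (u y).2) x| ≤ M)
    (hw : ContDiff ℝ (⊤ : ℕ∞) w) (hws : HasCompactSupport w) :
    |∫ x : ℝ × ℝ, curl (advect u w) x * curl w x|
      ≤ 3 * M * ((∫ x : ℝ × ℝ, (divg w x)^2) + ∫ x : ℝ × ℝ, (curl w x)^2) := by
  have key := abs_integral_transport_le hu.fst hu.snd hu11 hu12 hu21 hu22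
    hw.fst (hws.comp_left (g := Prod.fst) rfl) hw.snd (hws.comp_left (g := Prod.snd) rfl)
  have hD : 0 ≤ ∫ x, divg w x ^ 2 := integral_nonneg fun x => sq_nonneg _
  have hW : 0 ≤ ∫ x, curl w x ^ 2 := integral_nonneg fun x => sq_nonneg _
  calc |∫ x, curl (advect u w) x * curl w x|
      ≤ M * ((∫ x, divg w x ^ 2) + (∫ x, curl w x ^ 2) + ∫ x, curl w x ^ 2) := key
    _ ≤ 3 * M * ((∫ x, divg w x ^ 2) + ∫ x, curl w x ^ 2) := by
      nlinarith [mul_nonneg hM hD, mul_nonneg hM hW]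

end
end
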